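/- Let δ > 0 and let l₁, l₂ be odd integers in [2, l_max]. Let y, ȳ : {1,…,l₁+l₂+1} → ℝ² be configurations with (y₁,…,y_{l₁+2}) ∈ 𝒰^{l₁+1}_δ and (y_{l₁+2},…,y_{l₁+l₂+1}) ∈ 𝒰^{l₂−1}_δ, and suppose (ȳ₁,…,ȳ_{l₁+2}) ∈ 𝒰^{l₁+1} and (ȳ_{l₁+2},…,ȳ_{l₁+l₂+1}) ∈ 𝒰^{l₂−1} are associated configurations of the two pieces of y. Then |y_{l₁+l₂+1} − y₁| ≤ |ȳ_{l₁+l₂+1} − ȳ₁| + 2 l_max |φ_{l₁+2} − φ̄_{l₁+2}| + 4 l_max² δ, where φ_{l₁+2} and φ̄_{l₁+2} denote the junction angles of y and ȳ at the point with index l₁+2. -/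

import Mathlib

open Real

attribute [local instance] Classical.propDecidable

noncomputable section

/-- Counterclockwise angle from `a` to `b`, in `[0, 2π)`. -/
def ccwAngle (a b : ℂ) : ℝ :=
  if Complex.arg (b * (starRingEnd ℂ) a) < 0 then
    Complex.arg (b * (starRingEnd ℂ) a) + 2 * π
  else Complex.arg (b * (starRingEnd ℂ) a)

/-- Bond length `b_i`. -/
def bnd (y : ℕ → ℂ) (i : ℕ) : ℝ := ‖y (i + 1) - y i‖

/-- Bond angle `φ_i = ∡(y_{i-1} − y_i, y_{i+1} − y_i)`. -/
def ang (y : ℕ → ℂ) (i : ℕ) : ℝ := ccwAngle (y (i - 1) - y i) (y (i + 1) - y i)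

/-- Admissible configurations `𝒜_n` (atoms indexed `1,…,n`). -/
def Admissible (n : ℕ) (y : ℕ → ℂ) : Prop :=
  (∀ i j : ℕ, 1 ≤ i → i ≤ n → 1 ≤ j → j ≤ n → (i + 2 ≤ j ∨ j + 2 ≤ i) →
      (1.5 : ℝ) < ‖y i - y j‖) ∧
  (∀ i : ℕ, 1 ≤ i → i + 1 ≤ n → ‖y (i + 1) - y i‖ ≤ (1.5 : ℝ))

/-- Assumptions on the two-body potential `v₂` and the three-body potential `v₃`. -/
structure PotentialPair (v₂ v₃ : ℝ → ℝ) : Prop where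
  v₂_smooth : ContDiffOn ℝ (⊤ : ℕ∞) v₂ (Set.Ioi 0)
  v₂_lb : ∀ x ∈ Set.Ioi (0 : ℝ), (-1 : ℝ) ≤ v₂ x
  v₂_min : v₂ 1 = -1
  v₂_min_unique : ∀ x ∈ Set.Ioi (0 : ℝ), x ≠ 1 → v₂ 1 < v₂ x
  v₂_conv : 0 < iteratedDeriv 2 v₂ 1
  v₂_mono : StrictMonoOn v₂ (Set.Ici 1)
  v₃_smooth : ContDiffOn ℝ (⊤ : ℕ∞) v₃ (Set.Icc 0 (2 * π))
  v₃_nonneg : ∀ x ∈ Set.Icc (0 : ℝ) (2 * π), 0 ≤ v₃ x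
  v₃_symm : ∀ φ : ℝ, v₃ (π - φ) = v₃ (π + φ)
  v₃_min : v₃ π = 0
  v₃_min_unique : ∀ x ∈ Set.Icc (0 : ℝ) (2 * π), x ≠ π → 0 < v₃ x
  v₃_d1 : deriv v₃ π = 0
  v₃_d2 : iteratedDeriv 2 v₃ π = 0
  v₃_d3 : iteratedDeriv 3 v₃ π = 0
  v₃_d4 : 0 < iteratedDeriv 4 v₃ π

/-- The cell energy in terms of bond lengths and angle. -/
def EcellT (v₂ v₃ : ℝ → ℝ) (ρ b₁ b₂ φ : ℝ) : ℝ :=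
  v₂ b₁ + v₂ b₂ + ρ * v₂ (Real.sqrt (b₁ ^ 2 + b₂ ^ 2 - 2 * b₁ * b₂ * Real.cos φ)) + v₃ φ

/-- The cell energy. -/
def Ecell (v₂ v₃ : ℝ → ℝ) (ρ : ℝ) (p q r : ℂ) : ℝ :=
  v₂ ‖q - p‖ + v₂ ‖r - q‖ + v₃ (ccwAngle (r - q) (p - q)) + ρ * v₂ ‖r - p‖

/-- The reduced energy `E^red_n`. -/
def Ered (v₂ v₃ : ℝ → ℝ) (ρ : ℝ) (n : ℕ) (y : ℕ → ℂ) : ℝ :=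
  ∑ i ∈ Finset.Icc 2 (n - 1), Ecell v₂ v₃ ρ (y (i - 1)) (y i) (y (i + 1))

/-- `(b0, b0, π ± ψ)` are the only minimizers of the cell energy. -/
def IsCellMinimizer (v₂ v₃ : ℝ → ℝ) (ρ b0 ψ : ℝ) : Prop :=
  0 < b0 ∧ b0 < 1 ∧ 0 < ψ ∧ ψ < π / 8 ∧
  (∀ b₁ ∈ Set.Ioi (0 : ℝ), ∀ b₂ ∈ Set.Ioi (0 : ℝ), ∀ φ ∈ Set.Icc (0 : ℝ) (2 * π),
      EcellT v₂ v₃ ρ b0 b0 (π + ψ) ≤ EcellT v₂ v₃ ρ b₁ b₂ φ) ∧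
  (∀ b₁ ∈ Set.Ioi (0 : ℝ), ∀ b₂ ∈ Set.Ioi (0 : ℝ), ∀ φ ∈ Set.Icc (0 : ℝ) (2 * π),
      EcellT v₂ v₃ ρ b₁ b₂ φ = EcellT v₂ v₃ ρ b0 b0 (π + ψ) →
        b₁ = b0 ∧ b₂ = b0 ∧ (φ = π + ψ ∨ φ = π - ψ))

/-- The minimal cell energy `e_cell`. -/
def eCell (v₂ v₃ : ℝ → ℝ) (ρ b0 ψ : ℝ) : ℝ := EcellT v₂ v₃ ρ b0 b0 (π + ψ)

/-- `y` is a minimizer of `E^red_n` over `𝒜_n`. -/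
def MinimizesEred (v₂ v₃ : ℝ → ℝ) (ρ : ℝ) (n : ℕ) (y : ℕ → ℂ) : Prop :=
  Admissible n y ∧ ∀ y' : ℕ → ℂ, Admissible n y' → Ered v₂ v₃ ρ n y ≤ Ered v₂ v₃ ρ n y'

/-- Single-period configurations `𝒰^l`, with transition index `i₀`. -/
def memU (b0 ψ : ℝ) (l i₀ : ℕ) (y : ℕ → ℂ) : Prop :=
  2 ≤ i₀ ∧ i₀ + 1 ≤ l ∧
  (∀ i : ℕ, 1 ≤ i → i ≤ l → bnd y i = b0) ∧
  (∀ i : ℕ, 2 ≤ i → i ≤ i₀ → ang y i = π - ψ) ∧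
  (∀ i : ℕ, i₀ + 1 ≤ i → i ≤ l → ang y i = π + ψ)

/-- `⌈2π/ψ̄⌉`. -/
def nceil (ψ : ℝ) : ℕ := ⌈2 * π / ψ⌉₊

/-- The maximal atomic period `l_max = 2⌈2π/ψ̄⌉ − 4`. -/
def lmaxN (ψ : ℝ) : ℕ := 2 * nceil ψ - 4

/-- `l_mid = ⌊6/ψ̄⌋`. -/
def lmidN (ψ : ℝ) : ℕ := ⌊(6 : ℝ) / ψ⌋₊

/-- The end-to-end length `λ^l(i₀)` of a single-period configuration. -/
def lambdaFn (b0 ψ : ℝ) (l i₀ : ℕ) : ℝ :=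
  ‖∑ k ∈ Finset.Icc 1 l, (b0 : ℂ) * Complex.exp (Complex.I *
      (((if k ≤ i₀ then -(((k : ℝ) - 1) * ψ) else ((k : ℝ) - 2 * (i₀ : ℝ) + 1) * ψ) : ℝ) : ℂ))‖

/-- The domain of the function `λ^l`. -/
def lambdaDom (ψ : ℝ) (l : ℕ) : Finset ℕ :=
  (Finset.Icc 2 (l - 1)).filter fun i₀ => l + 3 ≤ i₀ + nceil ψ ∧ i₀ + 2 ≤ nceil ψ

/-- `λ^l_max`, the maximum of `λ^l` over its domain. -/
def lambdaMax (b0 ψ : ℝ) (l : ℕ) : ℝ :=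
  sSup (lambdaFn b0 ψ l '' ↑(lambdaDom ψ l))

/-- `f` is affine on `s`. -/
def AffOn (f : ℝ → ℝ) (s : Set ℝ) : Prop := ∃ a b : ℝ, ∀ x ∈ s, f x = a * x + b

/-- `Lam` is the normalized wavelength `Λ`. -/
def IsNormWavelength (b0 ψ : ℝ) (Lam : ℝ → ℝ) : Prop :=
  (∀ l : ℕ, 2 ≤ l → l ≤ lmidN ψ → Even l → Lam (l : ℝ) = lambdaMax b0 ψ l / (l : ℝ)) ∧
  (∀ l : ℕ, 4 ≤ l → l ≤ lmidN ψ → Even l → AffOn Lam (Set.Icc ((l : ℝ) - 2) (l : ℝ))) ∧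
  AffOn Lam (Set.Icc ((lmidN ψ : ℝ) - 2) (lmaxN ψ : ℝ))

/-- `y ∈ 𝒰^l_δ`, with associated configuration `ybar ∈ 𝒰^l`. -/
def AssocPerturb (b0 ψ δ : ℝ) (l : ℕ) (y ybar : ℕ → ℂ) : Prop :=
  Admissible (l + 1) y ∧ (∃ i₀ : ℕ, memU b0 ψ l i₀ ybar) ∧
  (∀ i : ℕ, 1 ≤ i → i ≤ l → |bnd y i - b0| ≤ δ) ∧
  (∀ i : ℕ, 2 ≤ i → i ≤ l → |ang y i - ang ybar i| ≤ δ)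

/-- `𝒜^δ_n`. -/
def AdmissiblePerturbed (b0 ψ δ : ℝ) (n : ℕ) (y : ℕ → ℂ) : Prop :=
  Admissible n y ∧ (∀ i : ℕ, 1 ≤ i → i + 1 ≤ n → |bnd y i - b0| ≤ δ) ∧
  (∀ i : ℕ, 2 ≤ i → i + 1 ≤ n → min |ang y i - (π + ψ)| |ang y i - (π - ψ)| ≤ δ)

/-- The property of the constant `c_mix` in the length estimate for odd atomic periods. -/
def MixConst (b0 ψ c : ℝ) : Prop :=
  ∀ l₁ l₂ : ℕ, Odd l₁ → Odd l₂ → 2 ≤ l₁ → l₁ ≤ lmaxN ψ → 2 ≤ l₂ → l₂ ≤ lmaxN ψ →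
    ∀ y : ℕ → ℂ,
      (∃ i₀ : ℕ, memU b0 ψ (l₁ + 1) i₀ y) →
      (∃ i₀ : ℕ, memU b0 ψ (l₂ - 1) i₀ (fun i => y (i + l₁ + 1))) →
      (∃ m : ℤ, ang y (l₁ + 2) - π = (2 * (m : ℝ) + 1) * ψ) →
      ‖y (l₁ + l₂ + 1) - y 1‖ ≤
        max (lambdaMax b0 ψ (l₁ + 1) + lambdaMax b0 ψ (l₂ - 1))
            (lambdaMax b0 ψ (l₁ - 1) + lambdaMax b0 ψ (l₂ + 1))
          - (if l₂ ≤ l₁ then c else 0)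

/-- `𝓘_sgn`. -/
def Isgn (n : ℕ) (y : ℕ → ℂ) : Finset ℕ :=
  ((Finset.Icc 3 (n - 2)).filter fun i => π < ang y i ∧ ang y (i + 1) < π) ∪ {1}

/-- `𝓘^l_sgn`. -/
def IsgnL (n : ℕ) (y : ℕ → ℂ) (l : ℕ) : Finset ℕ :=
  (Isgn n y).filter fun i =>
    (∀ k : ℕ, 1 ≤ k → k ≤ l - 1 → i + k ∉ Isgn n y) ∧ (i + l ∈ Isgn n y ∨ i + l = n)

/-- The maximal length of odd atomic periods `ℒ`. -/
def maxOddLength (ψ : ℝ) (Lam : ℝ → ℝ) (N S : ℕ) : ℝ :=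
  sSup { x : ℝ | ∃ r : ℕ → ℕ,
    (∀ l : ℕ, r l ≠ 0 → Even l ∧ 2 ≤ l ∧ l ≤ lmaxN ψ) ∧
    (∑ l ∈ Finset.Icc 2 (lmaxN ψ), r l) = N ∧
    (∑ l ∈ Finset.Icc 2 (lmaxN ψ), l * r l) = 2 * (S / 2) ∧
    x = ∑ l ∈ Finset.Icc 2 (lmaxN ψ), (r l : ℝ) * (l : ℝ) * Lam (l : ℝ) }

/-- The generalized cell energy. -/
def EgenCell (v₂ v₃ : ℝ → ℝ) (ρ ρ' : ℝ) (p q r s : ℂ) : ℝ :=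
  (Ecell v₂ v₃ ρ p q r + Ecell v₂ v₃ ρ q r s) / 2 + ρ' * v₂ ‖s - p‖

/-- The configurational (general) energy `E_n`. -/
def Egen (v₂ v₃ : ℝ → ℝ) (ρ ρ' : ℝ) (n : ℕ) (y : ℕ → ℂ) : ℝ :=
  Ered v₂ v₃ ρ n y + ρ' * ∑ i ∈ Finset.Icc 1 (n - 3), v₂ ‖y (i + 3) - y i‖

/-- The boundary condition `(y_n − y_1)·e₁ = (n−1)μ`. -/
def BC (n : ℕ) (μ : ℝ) (y : ℕ → ℂ) : Prop := (y n - y 1).re = ((n : ℝ) - 1) * μ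

/-- The minimal energy `E^{n,μ}_min`. -/
def Emin (v₂ v₃ : ℝ → ℝ) (ρ ρ' μ : ℝ) (n : ℕ) : ℝ :=
  sInf {E : ℝ | ∃ y : ℕ → ℂ, Admissible n y ∧ BC n μ y ∧ E = Egen v₂ v₃ ρ ρ' n y} /
    ((n : ℝ) - 2)

/-- `egen` is the common value `e^gen_cell`. -/
def IsEgenCellVal (v₂ v₃ : ℝ → ℝ) (ρ ρ' egen : ℝ) : Prop :=
  ∀ n : ℕ, ∀ y : ℕ → ℂ, MinimizesEred v₂ v₃ ρ n y →
    ∀ i : ℕ, 1 ≤ i → i + 3 ≤ n →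
      Real.sign (ang y (i + 1) - π) = Real.sign (ang y (i + 2) - π) →
        EgenCell v₂ v₃ ρ ρ' (y i) (y (i + 1)) (y (i + 2)) (y (i + 3)) = egen

/-- `eper` is the common value `e_per`. -/
def IsEperVal (v₂ v₃ : ℝ → ℝ) (ρ ρ' egen eper : ℝ) : Prop :=
  ∀ n : ℕ, ∀ y : ℕ → ℂ, MinimizesEred v₂ v₃ ρ n y →
    ∀ i : ℕ, 1 ≤ i → i + 3 ≤ n →
      Real.sign (ang y (i + 1) - π) ≠ Real.sign (ang y (i + 2) - π) →
        EgenCell v₂ v₃ ρ ρ' (y i) (y (i + 1)) (y (i + 2)) (y (i + 3)) = egen + ρ' * eper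

/-- `f` is piecewise affine on `s`. -/
def PiecewiseAffOn (f : ℝ → ℝ) (s : Set ℝ) : Prop :=
  ∃ P : Finset ℝ, ∀ a b : ℝ, a ∈ s → b ∈ s → a ≤ b → (∀ z ∈ P, z ∉ Set.Ioo a b) →
    AffOn f (Set.Icc a b ∩ s)

/-- The data `(e^gen_cell, e_range, c)` from the characterization of the minimal energy. -/
def EnergyChar (v₂ v₃ : ℝ → ℝ) (ρ ρ' m₁ m₂ egen : ℝ) (erange : ℝ → ℝ) (c : ℝ) : Prop :=
  0 < c ∧ StrictMonoOn erange (Set.Icc m₁ m₂) ∧ ConvexOn ℝ (Set.Icc m₁ m₂) erange ∧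
  PiecewiseAffOn erange (Set.Icc m₁ m₂) ∧
  ∀ μ ∈ Set.Icc m₁ m₂, ∀ n : ℕ, 3 ≤ n →
    |egen + ρ' * erange μ - Emin v₂ v₃ ρ ρ' μ n| ≤ c * (ρ' ^ 2 + 1 / (n : ℝ))

/-- The set of resonant lengths `M_res`. -/
def Mres (m₁ m₂ : ℝ) (erange : ℝ → ℝ) : Set ℝ :=
  {μ | μ ∈ Set.Icc m₁ m₂ ∧ ¬ DifferentiableWithinAt ℝ erange (Set.Icc m₁ m₂) μ}

/-- `𝒞(y)`, the set of atoms where the chain changes its curvature. -/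
def Cset (n : ℕ) (y : ℕ → ℂ) : Finset ℕ :=
  (Finset.Icc 2 (n - 2)).filter fun i => π < ang y i ∧ ang y (i + 1) < π

/-- `j` is the successor of `i` in `C`. -/
def SuccIn (C : Finset ℕ) (i j : ℕ) : Prop :=
  i ∈ C ∧ j ∈ C ∧ i < j ∧ ∀ k ∈ C, i < k → j ≤ k

/-- Almost minimizers of `E^{n,μ}_min`. -/
def AlmostMin (v₂ v₃ : ℝ → ℝ) (ρ ρ' μ c : ℝ) (n : ℕ) (y : ℕ → ℂ) : Prop :=
  Admissible n y ∧ BC n μ y ∧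
    Egen v₂ v₃ ρ ρ' n y / ((n : ℝ) - 2) ≤ Emin v₂ v₃ ρ ρ' μ n + c * (ρ' ^ 2 + 1 / (n : ℝ))

/-- The counterclockwise angle rotates the direction of `a` to the direction of `b`. -/
lemma ccwAngle_spec (a b : ℂ) (ha : a ≠ 0) (hb : b ≠ 0) :
    b / (‖b‖ : ℂ) = a / (‖a‖ : ℂ) * Complex.exp ((ccwAngle a b : ℝ) * Complex.I) := by
  have h1 : Complex.exp ((ccwAngle a b : ℝ) * Complex.I)
      = Complex.exp ((Complex.arg (b * (starRingEnd ℂ) a) : ℝ) * Complex.I) := by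
    unfold ccwAngle
    split_ifs
    · push_cast
      rw [add_mul, Complex.exp_add, Complex.exp_two_pi_mul_I, mul_one]
    · rfl
  rw [h1]
  have h2 := Complex.norm_mul_exp_arg_mul_I (b * (starRingEnd ℂ) a)
  set E := Complex.exp ((Complex.arg (b * (starRingEnd ℂ) a) : ℝ) * Complex.I)
  have ha' : (‖a‖ : ℂ) ≠ 0 := by simpa using ha
  have hb' : (‖b‖ : ℂ) ≠ 0 := by simpa using hb
  have h3 : a * (starRingEnd ℂ) a = (‖a‖ : ℂ) ^ 2 := by
    rw [Complex.mul_conj, Complex.normSq_eq_norm_sq]; push_cast; rfl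
  have hn : ‖b * (starRingEnd ℂ) a‖ = ‖b‖ * ‖a‖ := by simp
  rw [hn] at h2
  push_cast at h2
  rw [div_mul_eq_mul_div, div_eq_div_iff hb' ha']
  apply mul_right_cancel₀ ha'
  linear_combination (-b) * h3 + (-a) * h2

lemma norm_exp_sub_le (s t : ℝ) :
    ‖Complex.exp (s * Complex.I) - Complex.exp (t * Complex.I)‖ ≤ |s - t| := by
  have h : Complex.exp (s * Complex.I) - Complex.exp (t * Complex.I)
      = Complex.exp (t * Complex.I) * (Complex.exp (Complex.I * ((s - t : ℝ) : ℂ)) - 1) := by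
    rw [mul_sub, ← Complex.exp_add, mul_one]
    congr 2
    push_cast; ring
  rw [h, norm_mul, Complex.norm_exp_ofReal_mul_I, one_mul]
  exact Real.norm_exp_I_mul_ofReal_sub_one_le

lemma norm_unit (a : ℂ) (ha : a ≠ 0) : ‖a / (‖a‖ : ℂ)‖ = 1 := by
  rw [norm_div, Complex.norm_real, norm_norm, div_self (norm_ne_zero_iff.2 ha)]

/-- Propagation of the direction of the bonds. -/
lemma dir_step (y : ℕ → ℂ) (i : ℕ) (h1 : y (i + 1) - y i ≠ 0)
    (h2 : y (i + 2) - y (i + 1) ≠ 0) :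
    (y (i + 2) - y (i + 1)) / (‖y (i + 2) - y (i + 1)‖ : ℂ)
      = -((y (i + 1) - y i) / (‖y (i + 1) - y i‖ : ℂ)) *
        Complex.exp ((ang y (i + 1) : ℝ) * Complex.I) := by
  have h1' : y i - y (i + 1) ≠ 0 := by
    intro h; apply h1; linear_combination -h
  have h := ccwAngle_spec _ _ h1' h2
  have e : ang y (i + 1) = ccwAngle (y i - y (i + 1)) (y (i + 2) - y (i + 1)) := rfl
  rw [e, h, norm_sub_rev (y i)]
  congr 1
  rw [← neg_div, neg_sub]

/-- The general comparison of two chains, with one exceptional angle. -/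
lemma chain_compare (y z : ℕ → ℂ) (N j : ℕ) (δ ε : ℝ) (hδ : 0 ≤ δ) (hε : 0 ≤ ε) (hN : 1 ≤ N)
    (hy : ∀ i, 1 ≤ i → i ≤ N → y (i + 1) - y i ≠ 0)
    (hz : ∀ i, 1 ≤ i → i ≤ N → z (i + 1) - z i ≠ 0)
    (hz1 : ∀ i, 1 ≤ i → i ≤ N → bnd z i ≤ 1)
    (hb : ∀ i, 1 ≤ i → i ≤ N → |bnd y i - bnd z i| ≤ δ)
    (ha : ∀ i, 2 ≤ i → i ≤ N → i ≠ j → |ang y i - ang z i| ≤ δ)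
    (hj : |ang y j - ang z j| ≤ ε) :
    ‖y (N + 1) - y 1‖ ≤ ‖z (N + 1) - z 1‖ + N * (N * δ + ε) := by
  set u : ℕ → ℂ := fun i => (y (i + 1) - y i) / (‖y (i + 1) - y i‖ : ℂ) with hu
  set w : ℕ → ℂ := fun i => (z (i + 1) - z i) / (‖z (i + 1) - z i‖ : ℂ) with hw
  have hu1 : ∀ i, 1 ≤ i → i ≤ N → ‖u i‖ = 1 := fun i h h' => norm_unit _ (hy i h h')
  have hw1 : ∀ i, 1 ≤ i → i ≤ N → ‖w i‖ = 1 := fun i h h' => norm_unit _ (hz i h h')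
  set r : ℂ := u 1 / w 1 with hr
  have hw10 : w 1 ≠ 0 := by
    rw [← norm_ne_zero_iff, hw1 1 le_rfl hN]; exact one_ne_zero
  have hr1 : ‖r‖ = 1 := by
    rw [hr, norm_div, hu1 1 le_rfl hN, hw1 1 le_rfl hN, div_one]
  have key : ∀ k : ℕ, k + 1 ≤ N →
      ‖u (k + 1) - r * w (k + 1)‖ ≤ k * δ + (if j ≤ k + 1 then ε else 0) := by
    intro k
    induction k with
    | zero =>
      intro _
      have : u (0 + 1) - r * w (0 + 1) = 0 := by
        simp only [zero_add]
        rw [hr, div_mul_cancel₀ _ hw10, sub_self]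
      rw [this, norm_zero]
      split_ifs <;> simp [hε]
    | succ k ih =>
      intro hk
      have ih := ih (by omega)
      have e1 : u (k + 1 + 1) = -(u (k + 1)) * Complex.exp ((ang y (k + 2) : ℝ) * Complex.I) :=
        dir_step y (k + 1) (hy _ (by omega) (by omega)) (hy _ (by omega) (by omega))
      have e2 : w (k + 1 + 1) = -(w (k + 1)) * Complex.exp ((ang z (k + 2) : ℝ) * Complex.I) :=
        dir_step z (k + 1) (hz _ (by omega) (by omega)) (hz _ (by omega) (by omega))
      have e3 : u (k + 1 + 1) - r * w (k + 1 + 1)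
          = -((u (k + 1) - r * w (k + 1)) * Complex.exp ((ang y (k + 2) : ℝ) * Complex.I))
            - r * w (k + 1) * (Complex.exp ((ang y (k + 2) : ℝ) * Complex.I)
              - Complex.exp ((ang z (k + 2) : ℝ) * Complex.I)) := by
        rw [e1, e2]; ring
      have e4 : ‖u (k + 1 + 1) - r * w (k + 1 + 1)‖
          ≤ ‖u (k + 1) - r * w (k + 1)‖ + |ang y (k + 2) - ang z (k + 2)| := by
        rw [e3]
        refine (norm_sub_le _ _).trans ?_
        rw [norm_neg, norm_mul, Complex.norm_exp_ofReal_mul_I, mul_one, norm_mul, norm_mul, hr1,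
          hw1 _ (by omega) (by omega), one_mul, one_mul]
        have := norm_exp_sub_le (ang y (k + 2)) (ang z (k + 2))
        linarith
      have e5 : |ang y (k + 2) - ang z (k + 2)| + (if j ≤ k + 1 then ε else 0)
          ≤ δ + (if j ≤ k + 1 + 1 then ε else 0) := by
        by_cases hkj : k + 2 = j
        · rw [if_neg (by omega), if_pos (by omega), hkj]; linarith
        · have := ha (k + 2) (by omega) (by omega) hkj
          by_cases h : j ≤ k + 1
          · rw [if_pos h, if_pos (by omega)]; linarith
          · rw [if_neg h, if_neg (by omega)]; linarith
      push_cast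
      linarith
  have step : ∀ i, 1 ≤ i → i ≤ N →
      ‖(y (i + 1) - y i) - r * (z (i + 1) - z i)‖ ≤ N * δ + ε := by
    intro i h h'
    obtain ⟨k, rfl⟩ : ∃ k, i = k + 1 := ⟨i - 1, by omega⟩
    have hk := key k h'
    have hk2 : (k : ℝ) + 1 ≤ N := by exact_mod_cast h'
    have hy' : y (k + 1 + 1) - y (k + 1) = (bnd y (k + 1) : ℂ) * u (k + 1) := by
      have : (‖y (k + 1 + 1) - y (k + 1)‖ : ℂ) ≠ 0 := by
        simpa using hy (k + 1) h h'
      simp only [bnd, hu]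
      rw [mul_div_cancel₀ _ this]
    have hz' : z (k + 1 + 1) - z (k + 1) = (bnd z (k + 1) : ℂ) * w (k + 1) := by
      have : (‖z (k + 1 + 1) - z (k + 1)‖ : ℂ) ≠ 0 := by
        simpa using hz (k + 1) h h'
      simp only [bnd, hw]
      rw [mul_div_cancel₀ _ this]
    have e : (y (k + 1 + 1) - y (k + 1)) - r * (z (k + 1 + 1) - z (k + 1))
        = ((bnd y (k + 1) - bnd z (k + 1) : ℝ) : ℂ) * u (k + 1)
          + (bnd z (k + 1) : ℂ) * (u (k + 1) - r * w (k + 1)) := by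
      rw [hy', hz']; push_cast; ring
    rw [e]
    refine (norm_add_le _ _).trans ?_
    rw [norm_mul, norm_mul, Complex.norm_real, Complex.norm_real, hu1 _ h h', mul_one,
      Real.norm_eq_abs, Real.norm_eq_abs]
    have hbz0 : 0 ≤ bnd z (k + 1) := norm_nonneg _
    rw [abs_of_nonneg hbz0]
    have b1 := hb _ h h'
    have b2 : bnd z (k + 1) * ‖u (k + 1) - r * w (k + 1)‖ ≤ ‖u (k + 1) - r * w (k + 1)‖ :=
      mul_le_of_le_one_left (norm_nonneg _) (hz1 _ h h')
    have b3 : (if j ≤ k + 1 then ε else 0) ≤ ε := by split_ifs <;> simp [hε]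
    have b4 : (k + 1 : ℝ) * δ ≤ N * δ := mul_le_mul_of_nonneg_right hk2 hδ
    linarith
  have tot : ∀ n : ℕ, n ≤ N →
      ‖(y (n + 1) - y 1) - r * (z (n + 1) - z 1)‖ ≤ n * (N * δ + ε) := by
    intro n
    induction n with
    | zero => intro _; simp
    | succ n ih =>
      intro hn
      have ih := ih (by omega)
      have s := step (n + 1) (by omega) hn
      have e : (y (n + 1 + 1) - y 1) - r * (z (n + 1 + 1) - z 1)
          = ((y (n + 1) - y 1) - r * (z (n + 1) - z 1))
            + ((y (n + 1 + 1) - y (n + 1)) - r * (z (n + 1 + 1) - z (n + 1))) := by ring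
      rw [e]
      refine (norm_add_le _ _).trans ?_
      push_cast
      linarith
  have t := tot N le_rfl
  have e : y (N + 1) - y 1 = r * (z (N + 1) - z 1)
      + ((y (N + 1) - y 1) - r * (z (N + 1) - z 1)) := by ring
  rw [e]
  refine (norm_add_le _ _).trans ?_
  rw [norm_mul, hr1, one_mul]
  linarith

/-- Bonds of an admissible configuration with at least two bonds do not vanish. -/
lemma adm_bond_ne (n : ℕ) (hn : 3 ≤ n) (y : ℕ → ℂ) (h : Admissible n y) (i : ℕ) (hi : 1 ≤ i)
    (hi' : i + 1 ≤ n) : y (i + 1) - y i ≠ 0 := by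
  intro h0
  have h0 : y (i + 1) = y i := sub_eq_zero.1 h0
  by_cases hc : i + 2 ≤ n
  · have a := h.1 (i + 2) i (by omega) hc hi (by omega) (by omega)
    have b := h.2 (i + 1) (by omega) hc
    rw [h0] at b
    exact absurd a (not_lt.2 b)
  · obtain ⟨k, rfl⟩ : ∃ k, i = k + 1 := ⟨i - 1, by omega⟩
    have a := h.1 (k + 2) k (by omega) hi' (by omega) (by omega) (by omega)
    have b := h.2 k (by omega) (by omega)
    rw [← h0] at b
    exact absurd a (not_lt.2 b)

/-- the junction angle controls the length excess. -/
theorem junction_angle_controls_length (b0 ψ : ℝ) (hb0 : 0 < b0) (hb1 : b0 < 1)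
    (hψ0 : 0 < ψ) (hψ1 : ψ < π / 8) (δ : ℝ) (hδ : 0 < δ) :
    ∀ l₁ l₂ : ℕ, Odd l₁ → Odd l₂ → 2 ≤ l₁ → l₁ ≤ lmaxN ψ → 2 ≤ l₂ → l₂ ≤ lmaxN ψ →
      ∀ y ybar : ℕ → ℂ,
        AssocPerturb b0 ψ δ (l₁ + 1) y ybar →
        AssocPerturb b0 ψ δ (l₂ - 1) (fun i => y (i + l₁ + 1)) (fun i => ybar (i + l₁ + 1)) →
        ‖y (l₁ + l₂ + 1) - y 1‖ ≤ ‖ybar (l₁ + l₂ + 1) - ybar 1‖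
            + 2 * (lmaxN ψ : ℝ) * |ang y (l₁ + 2) - ang ybar (l₁ + 2)|
            + 4 * (lmaxN ψ : ℝ) ^ 2 * δ := by
  intro l₁ l₂ _ _ h1 h1' h2 h2' y z hA hB
  obtain ⟨A1, ⟨i₀, -, -, A2, -, -⟩, A3, A4⟩ := hA
  obtain ⟨B1, ⟨i₁, B0, B0', B2, -, -⟩, B3, B4⟩ := hB
  have hzb : ∀ i, 1 ≤ i → i ≤ l₁ + l₂ → bnd z i = b0 := by
    intro i hi hi'
    by_cases hc : i ≤ l₁ + 1
    · exact A2 i hi hc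
    · obtain ⟨k, rfl⟩ : ∃ k, i = k + l₁ + 1 := ⟨i - (l₁ + 1), by omega⟩
      have := B2 k (by omega) (by omega)
      simp only [bnd] at this ⊢
      rw [← this]
      congr 3; omega
  have hyb : ∀ i, 1 ≤ i → i ≤ l₁ + l₂ → |bnd y i - b0| ≤ δ := by
    intro i hi hi'
    by_cases hc : i ≤ l₁ + 1
    · exact A3 i hi hc
    · obtain ⟨k, rfl⟩ : ∃ k, i = k + l₁ + 1 := ⟨i - (l₁ + 1), by omega⟩
      have := B3 k (by omega) (by omega)
      have e : k + 1 + l₁ + 1 = k + l₁ + 1 + 1 := by omega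
      simpa only [bnd, e] using this
  have hang : ∀ i, 2 ≤ i → i ≤ l₁ + l₂ → i ≠ l₁ + 2 → |ang y i - ang z i| ≤ δ := by
    intro i hi hi' hne
    by_cases hc : i ≤ l₁ + 1
    · exact A4 i hi hc
    · obtain ⟨k, rfl⟩ : ∃ k, i = k + l₁ + 1 := ⟨i - (l₁ + 1), by omega⟩
      have := B4 k (by omega) (by omega)
      have e : k + 1 + l₁ + 1 = k + l₁ + 1 + 1 := by omega
      have e' : k - 1 + l₁ + 1 = k + l₁ + 1 - 1 := by omega
      simpa only [ang, e, e'] using this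
  have hy0 : ∀ i, 1 ≤ i → i ≤ l₁ + l₂ → y (i + 1) - y i ≠ 0 := by
    intro i hi hi'
    by_cases hc : i ≤ l₁ + 1
    · exact adm_bond_ne _ (by omega) y A1 i hi (by omega)
    · obtain ⟨k, rfl⟩ : ∃ k, i = k + l₁ + 1 := ⟨i - (l₁ + 1), by omega⟩
      have := adm_bond_ne _ (by omega) _ B1 k (by omega) (by omega)
      have e : k + 1 + l₁ + 1 = k + l₁ + 1 + 1 := by omega
      simpa only [e] using this
  have hz0 : ∀ i, 1 ≤ i → i ≤ l₁ + l₂ → z (i + 1) - z i ≠ 0 := by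
    intro i hi hi'
    have := hzb i hi hi'
    rw [← norm_ne_zero_iff]
    unfold bnd at this
    rw [this]; exact hb0.ne'
  have main := chain_compare y z (l₁ + l₂) (l₁ + 2) δ |ang y (l₁ + 2) - ang z (l₁ + 2)| hδ.le
    (abs_nonneg _) (by omega) hy0 hz0 (fun i h h' => by rw [hzb i h h']; exact hb1.le)
    (fun i h h' => by rw [hzb i h h']; exact hyb i h h') hang le_rfl
  refine main.trans ?_
  have hN : ((l₁ + l₂ : ℕ) : ℝ) ≤ 2 * (lmaxN ψ : ℝ) := by
    have : l₁ + l₂ ≤ 2 * lmaxN ψ := by omega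
    exact_mod_cast this
  have hN0 : (0 : ℝ) ≤ ((l₁ + l₂ : ℕ) : ℝ) := Nat.cast_nonneg _
  set N : ℝ := ((l₁ + l₂ : ℕ) : ℝ)
  set L : ℝ := (lmaxN ψ : ℝ)
  have hε := abs_nonneg (ang y (l₁ + 2) - ang z (l₁ + 2))
  set ε := |ang y (l₁ + 2) - ang z (l₁ + 2)|
  have c1 : N * ε ≤ 2 * L * ε := mul_le_mul_of_nonneg_right hN hε
  have c2 : N * N * δ ≤ (2 * L) * (2 * L) * δ :=
    mul_le_mul_of_nonneg_right (mul_le_mul hN hN hN0 (hN0.trans hN)) hδ.le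
  nlinarith [c1, c2]

end
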